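/- arXiv:1503.02569 — 4 statements merged into one kernel-verified Lean document; each statement's English description precedes it below -/
import Mathlib

section
/- Fix an integer q ≥ 5 and set D = q² − 4q, α_q = ((q−2) + √D)/2, β_q = ((q−2) − √D)/2. Let a_n, b_n be defined by a_1 = 0, b_1 = 0 and the recurrences a_{n+1} = a_n + b_n + 1, b_{n+1} = (q−4)·a_n + (q−3)·b_n, and let s_n = a_n + b_n + 2. Then for all n ≥ 1: a_n = ((2−q)/2 + (q²−4q+2)·√D/(2q(q−4)))·α_q^n + ((2−q)/2 − (q²−4q+2)·√D/(2q(q−4)))·β_q^n + 1; b_n = ((q−3)/2 + (1−q)·√D/(2q))·α_q^n + ((q−3)/2 − (1−q)·√D/(2q))·β_q^n − 1; and s_n = (−1/2 + (q−2)·√D/(2q(q−4)))·α_q^n + (−1/2 − (q−2)·√D/(2q(q−4)))·β_q^n + 2. -/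
/-- explicit formulae for `a_n`, `b_n` and `s_n = a_n + b_n + 2`, where
`a_1 = b_1 = 0`, `a_{n+1} = a_n + b_n + 1`, `b_{n+1} = (q-4)a_n + (q-3)b_n`, in terms of
`D = q² - 4q`, `α_q = ((q-2)+√D)/2` and `β_q = ((q-2)-√D)/2`. -/
theorem stmt_2 (q : ℕ) (hq : 5 ≤ q) (a b s : ℕ → ℝ)
    (ha1 : a 1 = 0) (hb1 : b 1 = 0)
    (ha : ∀ n, 1 ≤ n → a (n + 1) = a n + b n + 1)
    (hb : ∀ n, 1 ≤ n → b (n + 1) = ((q : ℝ) - 4) * a n + ((q : ℝ) - 3) * b n)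
    (hs : ∀ n, 1 ≤ n → s n = a n + b n + 2)
    (D α β : ℝ)
    (hD : D = (q : ℝ) ^ 2 - 4 * q)
    (hα : α = (((q : ℝ) - 2) + Real.sqrt D) / 2)
    (hβ : β = (((q : ℝ) - 2) - Real.sqrt D) / 2) :
    ∀ n, 1 ≤ n →
      a n = ((2 - (q : ℝ)) / 2
              + ((q : ℝ) ^ 2 - 4 * q + 2) / (2 * q * ((q : ℝ) - 4)) * Real.sqrt D) * α ^ n
            + ((2 - (q : ℝ)) / 2
              - ((q : ℝ) ^ 2 - 4 * q + 2) / (2 * q * ((q : ℝ) - 4)) * Real.sqrt D) * β ^ n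
            + 1 ∧
      b n = (((q : ℝ) - 3) / 2 + (1 - (q : ℝ)) / (2 * q) * Real.sqrt D) * α ^ n
            + (((q : ℝ) - 3) / 2 - (1 - (q : ℝ)) / (2 * q) * Real.sqrt D) * β ^ n
            - 1 ∧
      s n = (-(1 / 2) + ((q : ℝ) - 2) / (2 * q * ((q : ℝ) - 4)) * Real.sqrt D) * α ^ n
            + (-(1 / 2) - ((q : ℝ) - 2) / (2 * q * ((q : ℝ) - 4)) * Real.sqrt D) * β ^ n
            + 2 := by
  have hq5 : (5 : ℝ) ≤ q := by exact_mod_cast hq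
  have hq0 : (q : ℝ) ≠ 0 := by linarith
  have hq4 : (q : ℝ) - 4 ≠ 0 := by linarith
  have hr : Real.sqrt D ^ 2 = (q : ℝ) ^ 2 - 4 * q := by
    rw [Real.sq_sqrt (by rw [hD]; nlinarith), hD]
  clear hq hD
  generalize Real.sqrt D = r at *
  generalize (q : ℝ) = x at *
  have eigen : ∀ t : ℝ, t ^ 2 = x ^ 2 - 4 * x →
      ((2 - x) / 2 + (x ^ 2 - 4 * x + 2) / (2 * x * (x - 4)) * t) * (((x - 2) + t) / 2 - 1)
        = (x - 3) / 2 + (1 - x) / (2 * x) * t := by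
    intro t ht
    field_simp
    linear_combination (x ^ 2 - 4 * x + 2) * ht
  have hα2 : α ^ 2 = (x - 2) * α - 1 := by
    rw [hα]; linear_combination hr / 4
  have hβ2 : β ^ 2 = (x - 2) * β - 1 := by
    rw [hβ]; linear_combination hr / 4
  have eα := eigen r hr
  have eβ := eigen (-r) (by rw [neg_sq, hr])
  simp only [mul_neg, ← sub_eq_add_neg] at eα eβ
  rw [← hα] at eα
  rw [← hβ] at eβ
  have key : ∀ n, 1 ≤ n →
      a n = ((2 - x) / 2 + (x ^ 2 - 4 * x + 2) / (2 * x * (x - 4)) * r) * α ^ n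
            + ((2 - x) / 2 - (x ^ 2 - 4 * x + 2) / (2 * x * (x - 4)) * r) * β ^ n + 1 ∧
      b n = ((x - 3) / 2 + (1 - x) / (2 * x) * r) * α ^ n
            + ((x - 3) / 2 - (1 - x) / (2 * x) * r) * β ^ n - 1 := by
    intro n hn
    induction n, hn using Nat.le_induction with
    | base =>
      rw [ha1, hb1, hα, hβ]
      constructor
      · field_simp
        linear_combination (-2 * (x ^ 2 - 4 * x + 2)) * hr
      · field_simp
        linear_combination (-2 * (1 - x)) * hr
    | succ n hn ih =>
      rw [ha n hn, hb n hn, ih.1, ih.2, ← eα, ← eβ]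
      generalize (2 - x) / 2 + (x ^ 2 - 4 * x + 2) / (2 * x * (x - 4)) * r = A
      generalize (2 - x) / 2 - (x ^ 2 - 4 * x + 2) / (2 * x * (x - 4)) * r = B
      constructor
      · ring
      · linear_combination (-A * α ^ n) * hα2 - (B * β ^ n) * hβ2
  intro n hn
  obtain ⟨h1, h2⟩ := key n hn
  refine ⟨h1, h2, ?_⟩
  have hc : (x ^ 2 - 4 * x + 2) / (2 * x * (x - 4)) + (1 - x) / (2 * x)
      = (x - 2) / (2 * x * (x - 4)) := by
    field_simp
    ring
  rw [hs n hn, h1, h2, ← hc]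
  ring
end

section
/- Fix an integer q ≥ 5 and set D = q² − 2q − 7, α̂_q = ((q−1) + √D)/2, β̂_q = ((q−1) − √D)/2. Let â_n, b̂_n be defined by â_1 = 0, b̂_1 = 0 and the recurrences â_{n+1} = 2·â_n + 2·b̂_n + 2, b̂_{n+1} = (q−4)·â_n + (q−3)·b̂_n, and let ŝ_n = â_n + b̂_n + 2. Then for all n ≥ 1: â_n = ((1−q)/2 + (q²−2q−3)·√D/(2(q²−2q−7)))·α̂_q^n + ((1−q)/2 − (q²−2q−3)·√D/(2(q²−2q−7)))·β̂_q^n + 2; b̂_n = ((q−2)/2 − (q²−3q−2)·√D/(2(q²−2q−7)))·α̂_q^n + ((q−2)/2 + (q²−3q−2)·√D/(2(q²−2q−7)))·β̂_q^n − 2; and ŝ_n = (−1/2 + (q−1)·√D/(2(q²−2q−7)))·α̂_q^n + (−1/2 − (q−1)·√D/(2(q²−2q−7)))·β̂_q^n + 2. -/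
/-- For either square root `r` of `q² - 2q - 7`, the coefficients of `((q - 1 + r) / 2) ^ n` in the
explicit formulae form an eigenvector of the recurrence matrix. -/
theorem coeff_eigenvector {q r D : ℝ} (hD : D = q ^ 2 - 2 * q - 7) (hr : r ^ 2 = D)
    (hD₀ : D ≠ 0) :
    ((1 - q) / 2 + (q ^ 2 - 2 * q - 3) / (2 * D) * r) * ((q - 1 + r) / 2) =
        2 * ((1 - q) / 2 + (q ^ 2 - 2 * q - 3) / (2 * D) * r) +
        2 * ((q - 2) / 2 - (q ^ 2 - 3 * q - 2) / (2 * D) * r) ∧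
      ((q - 2) / 2 - (q ^ 2 - 3 * q - 2) / (2 * D) * r) * ((q - 1 + r) / 2) =
        (q - 4) * ((1 - q) / 2 + (q ^ 2 - 2 * q - 3) / (2 * D) * r) +
        (q - 3) * ((q - 2) / 2 - (q ^ 2 - 3 * q - 2) / (2 * D) * r) := by
  constructor
  · field_simp
    linear_combination (q ^ 2 - 2 * q - 3) * hr + (1 - q) * r * hD
  · field_simp
    linear_combination (-(q ^ 2 - 3 * q - 2)) * hr + (q - 2) * r * hD

/-- explicit formulae for `â_n`, `b̂_n` and `ŝ_n = â_n + b̂_n + 2`, where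
`â_1 = b̂_1 = 0`, `â_{n+1} = 2â_n + 2b̂_n + 2`, `b̂_{n+1} = (q-4)â_n + (q-3)b̂_n`,
in terms of `D = q² - 2q - 7`, `α̂_q = ((q-1)+√D)/2` and `β̂_q = ((q-1)-√D)/2`. -/
theorem stmt_5 (q : ℕ) (hq : 5 ≤ q) (a b s : ℕ → ℝ)
    (ha1 : a 1 = 0) (hb1 : b 1 = 0)
    (ha : ∀ n, 1 ≤ n → a (n + 1) = 2 * a n + 2 * b n + 2)
    (hb : ∀ n, 1 ≤ n → b (n + 1) = ((q : ℝ) - 4) * a n + ((q : ℝ) - 3) * b n)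
    (hs : ∀ n, 1 ≤ n → s n = a n + b n + 2)
    (D α β : ℝ)
    (hD : D = (q : ℝ) ^ 2 - 2 * q - 7)
    (hα : α = (((q : ℝ) - 1) + Real.sqrt D) / 2)
    (hβ : β = (((q : ℝ) - 1) - Real.sqrt D) / 2) :
    ∀ n, 1 ≤ n →
      a n = ((1 - (q : ℝ)) / 2
              + ((q : ℝ) ^ 2 - 2 * q - 3) / (2 * ((q : ℝ) ^ 2 - 2 * q - 7)) * Real.sqrt D)
              * α ^ n
            + ((1 - (q : ℝ)) / 2
              - ((q : ℝ) ^ 2 - 2 * q - 3) / (2 * ((q : ℝ) ^ 2 - 2 * q - 7)) * Real.sqrt D)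
              * β ^ n
            + 2 ∧
      b n = (((q : ℝ) - 2) / 2
              - ((q : ℝ) ^ 2 - 3 * q - 2) / (2 * ((q : ℝ) ^ 2 - 2 * q - 7)) * Real.sqrt D)
              * α ^ n
            + (((q : ℝ) - 2) / 2
              + ((q : ℝ) ^ 2 - 3 * q - 2) / (2 * ((q : ℝ) ^ 2 - 2 * q - 7)) * Real.sqrt D)
              * β ^ n
            - 2 ∧
      s n = (-(1 / 2) + ((q : ℝ) - 1) / (2 * ((q : ℝ) ^ 2 - 2 * q - 7)) * Real.sqrt D)
              * α ^ n
            + (-(1 / 2) - ((q : ℝ) - 1) / (2 * ((q : ℝ) ^ 2 - 2 * q - 7)) * Real.sqrt D)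
              * β ^ n
            + 2 := by
  have hq' : (5 : ℝ) ≤ q := by exact_mod_cast hq
  have hpos : 0 < D := by rw [hD]; nlinarith
  have hr : Real.sqrt D ^ 2 = D := Real.sq_sqrt hpos.le
  have hD₀ := hpos.ne'
  rw [← hD]
  generalize Real.sqrt D = r at hr hα hβ ⊢
  obtain ⟨hAα, hBα⟩ := coeff_eigenvector hD hr hD₀
  obtain ⟨hAβ, hBβ⟩ := coeff_eigenvector (r := -r) hD (by rw [neg_sq, hr]) hD₀
  simp only [mul_neg, sub_neg_eq_add, ← sub_eq_add_neg] at hAβ hBβ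
  rw [← hα] at hAα hBα
  rw [← hβ] at hAβ hBβ
  have key : ∀ n, 1 ≤ n →
      a n = ((1 - (q : ℝ)) / 2
              + ((q : ℝ) ^ 2 - 2 * q - 3) / (2 * D) * r)
              * α ^ n
            + ((1 - (q : ℝ)) / 2
              - ((q : ℝ) ^ 2 - 2 * q - 3) / (2 * D) * r)
              * β ^ n
            + 2 ∧
      b n = (((q : ℝ) - 2) / 2
              - ((q : ℝ) ^ 2 - 3 * q - 2) / (2 * D) * r)
              * α ^ n
            + (((q : ℝ) - 2) / 2
              + ((q : ℝ) ^ 2 - 3 * q - 2) / (2 * D) * r)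
              * β ^ n
            - 2 := by
    intro n hn
    induction n, hn using Nat.le_induction with
    | base =>
      rw [ha1, hb1, hα, hβ]
      constructor
      · field_simp
        linear_combination (-2 * (q ^ 2 - 2 * q - 3) : ℝ) * hr
      · field_simp
        linear_combination (2 * (q ^ 2 - 3 * q - 2) : ℝ) * hr
    | succ n hn ih =>
      obtain ⟨iha, ihb⟩ := ih
      rw [ha n hn, hb n hn, iha, ihb, pow_succ, pow_succ]
      constructor
      · linear_combination -α ^ n * hAα - β ^ n * hAβ
      · linear_combination -α ^ n * hBα - β ^ n * hBβ
  intro n hn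
  obtain ⟨h₁, h₂⟩ := key n hn
  refine ⟨h₁, h₂, ?_⟩
  rw [hs n hn, h₁, h₂]
  field_simp
  ring
end

section
/- Let a_n, b_n be defined by a_1 = 0, b_1 = 0 and the recurrences a_{n+1} = a_n + b_n + 1, b_{n+1} = a_n + 2·b_n, and let s_n = a_n + b_n + 2 (these are the counts of type-A vertices, type-B vertices, and all vertices of row n of the hyperbolic Pascal triangle {4,5}). Then each of {a_n}, {b_n}, {s_n} satisfies x_n = 4·x_{n−1} − 4·x_{n−2} + x_{n−3} for n ≥ 4, with initial values a_1 = 0, a_2 = 1, a_3 = 2; b_1 = 0, b_2 = 0, b_3 = 1; s_1 = 2, s_2 = 3, s_3 = 5. Moreover, with α₅ = (3+√5)/2 and β₅ = (3−√5)/2, for all n ≥ 1: a_n = (−3/2 + (7/10)·√5)·α₅^n + (−3/2 − (7/10)·√5)·β₅^n + 1; b_n = (1 − (2/5)·√5)·α₅^n + (1 + (2/5)·√5)·β₅^n − 1; and s_n = (−1/2 + (3/10)·√5)·α₅^n + (−1/2 − (3/10)·√5)·β₅^n + 2. -/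
/-- for the hyperbolic Pascal triangle `{4,5}`, with `a_1 = b_1 = 0`,
`a_{n+1} = a_n + b_n + 1`, `b_{n+1} = a_n + 2b_n`, `s_n = a_n + b_n + 2`: all three
sequences satisfy `x_n = 4x_{n-1} - 4x_{n-2} + x_{n-3}` (`n ≥ 4`), have the stated
initial values, and admit explicit formulae in `α₅ = (3+√5)/2`, `β₅ = (3-√5)/2`. -/
theorem stmt_6 (a b s : ℕ → ℝ)
    (ha1 : a 1 = 0) (hb1 : b 1 = 0)
    (ha : ∀ n, 1 ≤ n → a (n + 1) = a n + b n + 1)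
    (hb : ∀ n, 1 ≤ n → b (n + 1) = a n + 2 * b n)
    (hs : ∀ n, 1 ≤ n → s n = a n + b n + 2) :
    (∀ n, 4 ≤ n →
      a n = 4 * a (n - 1) - 4 * a (n - 2) + a (n - 3) ∧
      b n = 4 * b (n - 1) - 4 * b (n - 2) + b (n - 3) ∧
      s n = 4 * s (n - 1) - 4 * s (n - 2) + s (n - 3)) ∧
    a 1 = 0 ∧ a 2 = 1 ∧ a 3 = 2 ∧
    b 1 = 0 ∧ b 2 = 0 ∧ b 3 = 1 ∧
    s 1 = 2 ∧ s 2 = 3 ∧ s 3 = 5 ∧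
    (∀ n, 1 ≤ n →
      a n = (-(3 / 2) + 7 / 10 * Real.sqrt 5) * ((3 + Real.sqrt 5) / 2) ^ n
            + (-(3 / 2) - 7 / 10 * Real.sqrt 5) * ((3 - Real.sqrt 5) / 2) ^ n + 1 ∧
      b n = (1 - 2 / 5 * Real.sqrt 5) * ((3 + Real.sqrt 5) / 2) ^ n
            + (1 + 2 / 5 * Real.sqrt 5) * ((3 - Real.sqrt 5) / 2) ^ n - 1 ∧
      s n = (-(1 / 2) + 3 / 10 * Real.sqrt 5) * ((3 + Real.sqrt 5) / 2) ^ n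
            + (-(1 / 2) - 3 / 10 * Real.sqrt 5) * ((3 - Real.sqrt 5) / 2) ^ n + 2) := by
  have a2 := ha 1 le_rfl
  have a3 := ha 2 (by norm_num)
  have b2 := hb 1 le_rfl
  have b3 := hb 2 (by norm_num)
  have s1 := hs 1 le_rfl
  have s2 := hs 2 (by norm_num)
  have s3 := hs 3 (by norm_num)
  norm_num [ha1, hb1] at a2 b2 s1
  norm_num [a2, b2] at a3 b3 s2
  norm_num [a3, b3] at s3
  refine ⟨fun n hn => ?_, ha1, a2, a3, hb1, b2, b3, s1, s2, s3, fun n hn => ?_⟩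
  · obtain ⟨m, rfl⟩ := Nat.exists_eq_add_of_le' hn
    have e1 : m + 4 - 1 = m + 1 + 1 + 1 := rfl
    have e2 : m + 4 - 2 = m + 1 + 1 := rfl
    have e3 : m + 4 - 3 = m + 1 := rfl
    have e4 : m + 4 = m + 1 + 1 + 1 + 1 := rfl
    rw [e1, e2, e3, e4, hs (m + 1) (by lia), hs (m + 1 + 1) (by lia),
      hs (m + 1 + 1 + 1) (by lia), hs (m + 1 + 1 + 1 + 1) (by lia),
      ha (m + 1 + 1 + 1) (by lia), hb (m + 1 + 1 + 1) (by lia),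
      ha (m + 1 + 1) (by lia), hb (m + 1 + 1) (by lia),
      ha (m + 1) (by lia), hb (m + 1) (by lia)]
    refine ⟨?_, ?_, ?_⟩ <;> ring
  · have h5 : Real.sqrt 5 ^ 2 = 5 := Real.sq_sqrt (by norm_num)
    rw [hs n hn]
    generalize Real.sqrt 5 = r at h5 ⊢
    suffices h : a n = (-(3 / 2) + 7 / 10 * r) * ((3 + r) / 2) ^ n
            + (-(3 / 2) - 7 / 10 * r) * ((3 - r) / 2) ^ n + 1 ∧
        b n = (1 - 2 / 5 * r) * ((3 + r) / 2) ^ n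
            + (1 + 2 / 5 * r) * ((3 - r) / 2) ^ n - 1 by
      refine ⟨h.1, h.2, ?_⟩
      rw [h.1, h.2]
      ring
    induction n, hn using Nat.le_induction with
    | base =>
      rw [ha1, hb1]
      constructor
      · linear_combination -(7 / 10) * h5
      · linear_combination (2 / 5) * h5
    | succ n hn ih =>
      rw [ha n hn, hb n hn, ih.1, ih.2, pow_succ, pow_succ]
      generalize ((3 + r) / 2) ^ n = x
      generalize ((3 - r) / 2) ^ n = y
      constructor
      · linear_combination -(7 / 20) * (x + y) * h5
      · linear_combination (1 / 5) * (x + y) * h5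
end

section
/- Let s_n be defined by s_1 = 2, s_2 = 3, s_3 = 5 and the recurrence s_n = 4·s_{n−1} − 4·s_{n−2} + s_{n−3} for n ≥ 4 (the number of vertices of row n of the hyperbolic Pascal triangle {4,5}). Then the ratio s_{n+1}/s_n of the numbers of elements of two consecutive rows tends to (3+√5)/2 as n → ∞. -/
open Filter Topology in
theorem tendsto_fib_add_two_div_fib_atTop :
    Tendsto (fun n ↦ (Nat.fib (n + 2) / Nat.fib n : ℝ)) atTop (𝓝 (Real.goldenRatio ^ 2)) := by
  have h := (tendsto_fib_succ_div_fib_atTop.comp (tendsto_add_atTop_nat 1)).mul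
    tendsto_fib_succ_div_fib_atTop
  rw [← sq] at h
  refine h.congr fun n ↦ div_mul_div_cancel₀ ?_
  exact_mod_cast (Nat.fib_pos.2 n.succ_pos).ne'

open Filter in
theorem tendsto_fib_atTop : Tendsto Nat.fib atTop atTop :=
  tendsto_atTop_mono' atTop ((eventually_ge_atTop 5).mono fun _ ↦ Nat.le_fib_self) tendsto_id

theorem eq_fib_two_mul_add_two (s : ℕ → ℤ) (h1 : s 1 = 2) (h2 : s 2 = 3) (h3 : s 3 = 5)
    (hrec : ∀ n, 4 ≤ n → s n = 4 * s (n - 1) - 4 * s (n - 2) + s (n - 3)) :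
    ∀ n, s (n + 1) = Nat.fib (2 * n) + 2
  | 0 => by simpa using h1
  | 1 => by simpa using h2
  | 2 => by simpa [Nat.fib_add_two] using h3
  | n + 3 => by
    have ih0 := eq_fib_two_mul_add_two s h1 h2 h3 hrec n
    have ih1 := eq_fib_two_mul_add_two s h1 h2 h3 hrec (n + 1)
    have ih2 := eq_fib_two_mul_add_two s h1 h2 h3 hrec (n + 2)
    have h : s (n + 4) = 4 * s (n + 3) - 4 * s (n + 2) + s (n + 1) := hrec (n + 4) (by lia)
    rw [h, ih0, ih1, ih2]
    simp only [mul_add, Nat.reduceMul, Nat.fib_add_two]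
    push_cast
    ring

/-- if `s_1 = 2`, `s_2 = 3`, `s_3 = 5` and
`s_n = 4s_{n-1} - 4s_{n-2} + s_{n-3}` for `n ≥ 4`, then the ratio `s_{n+1}/s_n`
tends to `(3+√5)/2`. -/
theorem stmt_7 (s : ℕ → ℤ) (h1 : s 1 = 2) (h2 : s 2 = 3) (h3 : s 3 = 5)
    (hrec : ∀ n, 4 ≤ n → s n = 4 * s (n - 1) - 4 * s (n - 2) + s (n - 3)) :
    Filter.Tendsto (fun n => (s (n + 1) : ℝ) / (s n : ℝ)) Filter.atTop
      (nhds ((3 + Real.sqrt 5) / 2)) := by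
  have hs := eq_fib_two_mul_add_two s h1 h2 h3 hrec
  have hdouble : Filter.Tendsto (fun n : ℕ ↦ 2 * n) Filter.atTop Filter.atTop :=
    Filter.tendsto_id.const_mul_atTop' two_pos
  have hratio := tendsto_fib_add_two_div_fib_atTop.comp hdouble
  have hinv : Filter.Tendsto (fun n : ℕ ↦ 2 / (Nat.fib (2 * n) : ℝ)) Filter.atTop (nhds 0) :=
    (tendsto_natCast_atTop_atTop.comp (tendsto_fib_atTop.comp hdouble)).const_div_atTop 2
  have hlim := (hratio.add hinv).div (hinv.const_add 1) (by norm_num)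
  have hval : (Real.goldenRatio ^ 2 + 0) / (1 + 0) = (3 + Real.sqrt 5) / 2 := by
    rw [add_zero, add_zero, div_one, Real.goldenRatio_sq, Real.goldenRatio]
    ring
  rw [hval] at hlim
  rw [← Filter.tendsto_add_atTop_iff_nat 1]
  refine hlim.congr' ?_
  filter_upwards [Filter.eventually_gt_atTop 0] with n hn
  have hpos : (0 : ℝ) < Nat.fib (2 * n) := by exact_mod_cast Nat.fib_pos.2 (by lia)
  rw [hs n, hs (n + 1)]
  simp only [Pi.div_apply, Function.comp_apply, mul_add, mul_one]
  push_cast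
  field_simp
end
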